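/- Let A and B be unital locally matrix algebras over a field F, each of dimension at most ℵ₀ over F. Then A and B are Morita equivalent if and only if their Steinitz numbers are rationally connected, i.e., there exist positive integers k and l such that {m : m divides k·d for some d ∈ D(A)} = {m : m divides l·d for some d ∈ D(B)}. -/

import Mathlib

/-- A unital locally matrix algebra over a field `F`: every finite subset lies in a
unital subalgebra (automatically containing `1`) isomorphic to a full matrix algebra
`M_n(F)` for some `n ≥ 1`. -/
def IsUnitalLocallyMatrix (F : Type*) [Field F] (A : Type*) [Ring A] [Algebra F A] : Prop :=
  ∀ s : Finset A, ∃ (n : ℕ) (B : Subalgebra F A), 1 ≤ n ∧ (↑s : Set A) ⊆ B ∧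
    Nonempty (B ≃ₐ[F] Matrix (Fin n) (Fin n) F)

/-- `D(A)`: the set of positive integers `n` such that `A` has a unital subalgebra
(containing `1`) isomorphic to `M_n(F)`. -/
def matrixDegrees (F : Type*) [Field F] (A : Type*) [Ring A] [Algebra F A] : Set ℕ :=
  {n | 1 ≤ n ∧ ∃ B : Subalgebra F A, Nonempty (B ≃ₐ[F] Matrix (Fin n) (Fin n) F)}

/-- Two unital algebras are Morita equivalent if the categories of their left modules
are equivalent. -/
def MoritaEquiv (A : Type u) (B : Type v) [Ring A] [Ring B] : Prop :=
  Nonempty (ModuleCat.{max u v} A ≌ ModuleCat.{max u v} B)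

open scoped Kronecker

/-- A system of `d × d` matrix units in `R` whose diagonal elements sum to `ε`. -/
def HasMatrixUnits {R : Type*} [Ring R] (ε : R) (d : ℕ) : Prop :=
  ∃ e : Fin d → Fin d → R,
    (∀ i j k l, e i j * e k l = if j = k then e i l else 0) ∧ ∑ i, e i i = ε

namespace HasMatrixUnits

variable {R S : Type*} [Ring R] [Ring S] {ε : R} {d : ℕ}

theorem map {G : Type*} [FunLike G R S] [NonUnitalRingHomClass G R S] (f : G)
    (h : HasMatrixUnits ε d) : HasMatrixUnits (f ε) d := by
  obtain ⟨e, he, hs⟩ := h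
  refine ⟨fun i j => f (e i j), fun i j k l => ?_, ?_⟩
  · rw [← map_mul, he]
    split_ifs <;> simp
  · rw [← hs, map_sum]

theorem map_ringEquiv_iff (f : R ≃+* S) : HasMatrixUnits (f ε) d ↔ HasMatrixUnits ε d :=
  ⟨fun h => by simpa using h.map f.symm, fun h => h.map f⟩

theorem one_iff_of_ringEquiv (f : R ≃+* S) :
    HasMatrixUnits (1 : R) d ↔ HasMatrixUnits (1 : S) d := by
  rw [← map_ringEquiv_iff f, map_one]

theorem op (h : HasMatrixUnits ε d) : HasMatrixUnits (MulOpposite.op ε) d := by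
  obtain ⟨e, he, hs⟩ := h
  refine ⟨fun i j => MulOpposite.op (e j i), fun i j k l => ?_, ?_⟩
  · rw [← MulOpposite.op_mul, he]
    by_cases hjk : j = k
    · simp [hjk]
    · simp [hjk, Ne.symm hjk]
  · rw [← hs, Finset.op_sum]

theorem one_op_iff : HasMatrixUnits (1 : Rᵐᵒᵖ) d ↔ HasMatrixUnits (1 : R) d :=
  ⟨fun h => (one_iff_of_ringEquiv (RingEquiv.opOp R)).2 h.op, fun h => h.op⟩

/-- Matrix units over an arbitrary finite index type. -/
theorem of_fintype {ι : Type*} [Fintype ι] [DecidableEq ι] (e : ι → ι → R)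
    (he : ∀ i j k l, e i j * e k l = if j = k then e i l else 0) (hs : ∑ i, e i i = ε) :
    HasMatrixUnits ε (Fintype.card ι) := by
  let g := (Fintype.equivFin ι).symm
  refine ⟨fun i j => e (g i) (g j), fun i j k l => ?_, ?_⟩
  · rw [he]
    simp
  · rw [← hs]
    exact Fintype.sum_equiv g _ _ fun _ => rfl

/-- Matrix units in the corner cut out by the idempotent `ε` of a ring `R` correspond to matrix
units in a ring `E` identified with this corner by maps `f` and `g`. -/
theorem corner_iff {E : Type*} [Ring E] (f : E →ₙ+* R) (g : R →+ E) (hf : f 1 = ε)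
    (hg : ∀ x y, g (x * ε * y) = g x * g y) (hg1 : g ε = 1) :
    HasMatrixUnits (1 : E) d ↔ HasMatrixUnits ε d := by
  refine ⟨fun h => hf ▸ h.map f, fun ⟨e, he, hs⟩ => ⟨fun i j => g (e i j), fun i j k l => ?_, ?_⟩⟩
  · have h1 : e i j * ε = e i j := by simp [← hs, Finset.mul_sum, he]
    rw [← hg, h1, he]
    split_ifs <;> simp
  · rw [← hg1, ← hs, map_sum]

end HasMatrixUnits

/-- `ε` is an idempotent matrix of rank `Fintype.card ι`, as witnessed by a full rank
factorization. -/
def FactorsThrough (F : Type*) [Field F] {m : Type*} [Fintype m] [DecidableEq m]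
    (ε : Matrix m m F) (ι : Type*) [Fintype ι] [DecidableEq ι] : Prop :=
  ∃ (U : Matrix m ι F) (V : Matrix ι m F), U * V = ε ∧ V * U = 1

section Matrix

variable {F : Type*} [Field F] {m ι κ : Type*} [Fintype m] [DecidableEq m] [Fintype ι]
  [DecidableEq ι] [Fintype κ] [DecidableEq κ]

theorem FactorsThrough.card_eq {ε : Matrix m m F} (h₁ : FactorsThrough F ε ι)
    (h₂ : FactorsThrough F ε κ) : Fintype.card ι = Fintype.card κ := by
  obtain ⟨U, V, hUV, hVU⟩ := h₁
  obtain ⟨U', V', hUV', hVU'⟩ := h₂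
  refine Matrix.square_of_invertible (R := F) (V * U') (V' * U) ?_ ?_
  · calc V * U' * (V' * U) = V * (U' * V') * U := by simp only [Matrix.mul_assoc]
      _ = (V * U) * (V * U) := by rw [hUV', ← hUV]; simp only [Matrix.mul_assoc]
      _ = 1 := by rw [hVU, Matrix.mul_one]
  · calc V' * U * (V * U') = V' * (U * V) * U' := by simp only [Matrix.mul_assoc]
      _ = (V' * U') * (V' * U') := by rw [hUV, ← hUV']; simp only [Matrix.mul_assoc]
      _ = 1 := by rw [hVU', Matrix.mul_one]

theorem FactorsThrough.one : FactorsThrough F (1 : Matrix m m F) m :=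
  ⟨1, 1, by simp, by simp⟩

theorem exists_factorsThrough {ε : Matrix m m F} (hε : ε * ε = ε) :
    ∃ r : ℕ, FactorsThrough F ε (Fin r) := by
  let f := Matrix.toLin' ε
  have hff : ∀ x, f (f x) = f x := fun x => by
    simp only [f, Matrix.toLin'_apply, Matrix.mulVec_mulVec, hε]
  let b := (Module.finBasis F (LinearMap.range f)).equivFun
  let u := (LinearMap.range f).subtype ∘ₗ b.symm.toLinearMap
  let v := b.toLinearMap ∘ₗ f.rangeRestrict
  refine ⟨_, LinearMap.toMatrix' u, LinearMap.toMatrix' v, ?_, ?_⟩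
  · rw [← LinearMap.toMatrix'_comp]
    have : u ∘ₗ v = f := by
      ext x
      simp [u, v]
    rw [this, LinearMap.toMatrix'_toLin']
  · rw [← LinearMap.toMatrix'_comp]
    have : v ∘ₗ u = LinearMap.id := by
      refine LinearMap.ext fun x => ?_
      have : f.rangeRestrict (b.symm x) = b.symm x := by
        obtain ⟨y, hy⟩ := (b.symm x).2
        exact Subtype.ext (show f (b.symm x : m → F) = _ by rw [← hy, hff])
      simp only [u, v, LinearMap.comp_apply, Submodule.subtype_apply, LinearEquiv.coe_coe, this,
        LinearEquiv.apply_symm_apply, LinearMap.id_apply]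
    rw [this, LinearMap.toMatrix'_id]

/-- Matrix units in a matrix algebra over a field are standard up to a choice of coordinates. -/
theorem exists_standard_form {d : ℕ} (hd : 1 ≤ d) (e : Fin d → Fin d → Matrix m m F)
    (he : ∀ i j k l, e i j * e k l = if j = k then e i l else 0) :
    ∃ (r : ℕ) (U : Matrix m (Fin d × Fin r) F) (V : Matrix (Fin d × Fin r) m F),
      U * V = ∑ i, e i i ∧ V * U = 1 ∧
        ∀ i j, U * (Matrix.single i j (1 : F) ⊗ₖ (1 : Matrix (Fin r) (Fin r) F)) * V = e i j := by
  let z : Fin d := ⟨0, hd⟩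
  obtain ⟨r, P, Q, hPQ, hQP⟩ := exists_factorsThrough (ε := e z z) (by simp [he])
  let U : Matrix m (Fin d × Fin r) F := .of fun p ic => (e ic.1 z * P) p ic.2
  let V : Matrix (Fin d × Fin r) m F := .of fun ic p => (Q * e z ic.1) ic.2 p
  have hPQ' : ∀ i j, e i z * P * (Q * e z j) = e i j := fun i j => by
    rw [Matrix.mul_assoc, ← Matrix.mul_assoc P, hPQ, he]
    simp [he]
  refine ⟨r, U, V, ?_, ?_, ?_⟩
  · simp_rw [← fun i => hPQ' i i]
    ext p q
    simp [U, V, Matrix.mul_apply (M := U), Matrix.sum_apply,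
      Matrix.mul_apply (M := e _ z * P), Fintype.sum_prod_type]
  · have h : ∀ i j, Q * e z i * (e j z * P) = if i = j then 1 else 0 := fun i j => by
      rw [Matrix.mul_assoc, ← Matrix.mul_assoc (e z i), he]
      split_ifs
      · rw [← hPQ, Matrix.mul_assoc, hQP, Matrix.mul_one, hQP]
      · simp
    ext ⟨i, a⟩ ⟨j, b⟩
    have : (V * U) (i, a) (j, b) = (Q * e z i * (e j z * P)) a b := rfl
    rw [this, h]
    by_cases hij : i = j
    · simp [hij, Matrix.one_apply]
    · simp [hij]
  · intro i j
    rw [← hPQ']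
    ext p q
    have h1 : ∀ k a, (U * (Matrix.single i j (1 : F) ⊗ₖ (1 : Matrix (Fin r) (Fin r) F))) p (k, a) =
        if j = k then U p (i, a) else 0 := fun k a => by
      simp [Matrix.mul_apply, Fintype.sum_prod_type, Matrix.single_apply, Matrix.one_apply,
        ite_and]
    rw [Matrix.mul_apply, Fintype.sum_prod_type]
    simp_rw [h1]
    rw [Finset.sum_eq_single j (fun b _ hb => by simp [Ne.symm hb]) (by simp)]
    simp [U, V, Matrix.mul_apply (M := e _ z * P)]

theorem HasMatrixUnits.exists_factorsThrough {ε : Matrix m m F} {d : ℕ} (hd : 1 ≤ d)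
    (h : HasMatrixUnits ε d) : ∃ r : ℕ, FactorsThrough F ε (Fin d × Fin r) := by
  obtain ⟨e, he, rfl⟩ := h
  obtain ⟨r, U, V, hUV, hVU, -⟩ := exists_standard_form hd e he
  exact ⟨r, U, V, hUV, hVU⟩

theorem FactorsThrough.hasMatrixUnits {ε : Matrix m m F} (h : FactorsThrough F ε ι) :
    HasMatrixUnits ε (Fintype.card ι) := by
  obtain ⟨U, V, rfl, hVU⟩ := h
  refine .of_fintype (fun i j => U * Matrix.single i j (1 : F) * V) (fun i j k l => ?_) ?_
  · calc _ = U * (Matrix.single i j (1 : F) * (V * U) * Matrix.single k l (1 : F)) * V := by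
          simp only [Matrix.mul_assoc]
      _ = _ := by
          rw [hVU, Matrix.mul_one]
          split_ifs with hjk
          · subst hjk
            simp
          · simp [Matrix.single_mul_single_of_ne _ _ _ _ hjk]
  · rw [← Matrix.sum_mul, ← Matrix.mul_sum, Matrix.sum_single_one, Matrix.mul_one]

theorem exists_algHom_standard_form {d : ℕ} (hd : 1 ≤ d)
    (f : Matrix (Fin d) (Fin d) F →ₐ[F] Matrix m m F) :
    ∃ (r : ℕ) (U : Matrix m (Fin d × Fin r) F) (V : Matrix (Fin d × Fin r) m F),
      U * V = 1 ∧ V * U = 1 ∧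
        ∀ x, f x = U * (x ⊗ₖ (1 : Matrix (Fin r) (Fin r) F)) * V := by
  obtain ⟨r, U, V, hUV, hVU, h⟩ := exists_standard_form hd (fun i j => f (Matrix.single i j 1))
    (fun i j k l => by
      rw [← map_mul]
      split_ifs with hjk
      · subst hjk
        simp
      · simp [Matrix.single_mul_single_of_ne _ _ _ _ hjk])
  refine ⟨r, U, V, ?_, hVU, fun x => ?_⟩
  · rw [hUV, ← map_sum, Matrix.sum_single_one, map_one]
  · induction x using Matrix.induction_on' with
    | h_zero => simp
    | h_add p q hp hq => rw [map_add, hp, hq, Matrix.add_kronecker, Matrix.mul_add, Matrix.add_mul]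
    | h_std_basis i j c =>
      have : Matrix.single i j c = c • Matrix.single i j (1 : F) := by simp [Matrix.smul_single]
      rw [this, map_smul, ← h, Matrix.smul_kronecker, Matrix.mul_smul, Matrix.smul_mul]

/-- Any two unital homomorphisms between full matrix algebras are conjugate. -/
theorem exists_comp_eq_of_algHom {d : ℕ} (hd : 1 ≤ d)
    (f g : Matrix (Fin d) (Fin d) F →ₐ[F] Matrix m m F) :
    ∃ c : Matrix m m F →ₐ[F] Matrix m m F, c.comp f = g := by
  obtain ⟨r, U, V, hUV, hVU, h⟩ := exists_algHom_standard_form hd f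
  obtain ⟨s, U', V', hUV', hVU', h'⟩ := exists_algHom_standard_form hd g
  have hrs : r = s := by
    have h₁ : FactorsThrough F (1 : Matrix m m F) (Fin d × Fin r) := ⟨U, V, hUV, hVU⟩
    have := h₁.card_eq (⟨U', V', hUV', hVU'⟩ : FactorsThrough F _ (Fin d × Fin s))
    simp only [Fintype.card_prod, Fintype.card_fin] at this
    exact Nat.eq_of_mul_eq_mul_left hd this
  subst hrs
  have h₁ : U' * V * (U * V') = 1 := by
    rw [Matrix.mul_assoc, ← Matrix.mul_assoc V, hVU, Matrix.one_mul, hUV']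
  have h₂ : U * V' * (U' * V) = 1 := by
    rw [Matrix.mul_assoc, ← Matrix.mul_assoc V', hVU', Matrix.one_mul, hUV]
  refine ⟨AlgHom.ofLinearMap (LinearMap.mulLeft F (U' * V) ∘ₗ LinearMap.mulRight F (U * V'))
    ?_ fun x y => ?_, AlgHom.ext fun x => ?_⟩
  · simpa using h₁
  · simp only [LinearMap.comp_apply, LinearMap.mulLeft_apply, LinearMap.mulRight_apply]
    calc _ = U' * V * x * (U * V' * (U' * V)) * y * (U * V') := by
          rw [h₂]; simp only [mul_assoc, one_mul]
      _ = _ := by simp only [mul_assoc]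
  · simp only [AlgHom.comp_apply, AlgHom.ofLinearMap_apply, LinearMap.comp_apply,
      LinearMap.mulLeft_apply, LinearMap.mulRight_apply, h, h']
    calc _ = U' * ((V * U) * (x ⊗ₖ (1 : Matrix (Fin r) (Fin r) F)) * (V * U)) * V' := by
          simp only [Matrix.mul_assoc]
      _ = _ := by rw [hVU, Matrix.one_mul, Matrix.mul_one, Matrix.mul_assoc]

theorem FactorsThrough.map_algHom {d : ℕ} (hd : 1 ≤ d)
    (f : Matrix (Fin d) (Fin d) F →ₐ[F] Matrix m m F) {ε : Matrix (Fin d) (Fin d) F}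
    (hε : FactorsThrough F ε ι) :
    ∃ t : ℕ, Fintype.card m = d * t ∧ FactorsThrough F (f ε) (ι × Fin t) := by
  obtain ⟨r, U, V, hUV, hVU, h⟩ := exists_algHom_standard_form hd f
  obtain ⟨P, Q, rfl, hQP⟩ := hε
  refine ⟨r, ?_, U * (P ⊗ₖ (1 : Matrix (Fin r) (Fin r) F)),
    (Q ⊗ₖ (1 : Matrix (Fin r) (Fin r) F)) * V, ?_, ?_⟩
  · simpa using FactorsThrough.one.card_eq
      (⟨U, V, hUV, hVU⟩ : FactorsThrough F (1 : Matrix m m F) (Fin d × Fin r))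
  · rw [h, ← Matrix.one_mul (1 : Matrix (Fin r) (Fin r) F), Matrix.mul_kronecker_mul]
    simp only [Matrix.mul_assoc, Matrix.one_mul]
  · rw [Matrix.mul_assoc, ← Matrix.mul_assoc V, hVU, Matrix.one_mul, ← Matrix.mul_kronecker_mul,
      hQP, Matrix.one_mul, Matrix.one_kronecker_one]

end Matrix

section LocallyMatrix

variable {F : Type*} [Field F] {A : Type*} [Ring A] [Algebra F A]

theorem isUnitalLocallyMatrix_iff : IsUnitalLocallyMatrix F A ↔
    ∀ s : Set A, s.Finite → ∃ n : ℕ, 1 ≤ n ∧ ∃ f : Matrix (Fin n) (Fin n) F →ₐ[F] A,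
      Function.Injective f ∧ s ⊆ Set.range f := by
  refine ⟨fun h s hs => ?_, fun h s => ?_⟩
  · obtain ⟨n, B, hn, hB, ⟨g⟩⟩ := h hs.toFinset
    refine ⟨n, hn, B.val.comp g.symm.toAlgHom, ?_, fun x hx => ?_⟩
    · exact Subtype.val_injective.comp g.symm.injective
    · exact ⟨g ⟨x, hB (by simpa using hx)⟩, by simp⟩
  · obtain ⟨n, hn, f, hf, hs⟩ := h s s.finite_toSet
    exact ⟨n, f.range, hn, hs, ⟨(AlgEquiv.ofInjective f hf).symm⟩⟩

theorem AlgHom.exists_comp_eq {R X Y Z : Type*} [CommSemiring R] [Semiring X] [Semiring Y]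
    [Semiring Z] [Algebra R X] [Algebra R Y] [Algebra R Z] {f : Y →ₐ[R] Z}
    (hf : Function.Injective f) {φ : X →ₐ[R] Z} (h : ∀ x, φ x ∈ f.range) :
    ∃ g : X →ₐ[R] Y, f.comp g = φ :=
  ⟨(AlgEquiv.ofInjective f hf).symm.toAlgHom.comp (φ.codRestrict f.range h), AlgHom.ext fun x =>
    congrArg Subtype.val
      ((AlgEquiv.ofInjective f hf).apply_symm_apply (φ.codRestrict f.range h x))⟩

namespace IsUnitalLocallyMatrix

theorem nontrivial (hA : IsUnitalLocallyMatrix F A) : Nontrivial A := by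
  obtain ⟨n, hn, f, hf, -⟩ := isUnitalLocallyMatrix_iff.1 hA ∅ Set.finite_empty
  have : Nonempty (Fin n) := ⟨⟨0, hn⟩⟩
  exact hf.nontrivial

theorem mem_matrixDegrees_iff (hA : IsUnitalLocallyMatrix F A) {d : ℕ} :
    d ∈ matrixDegrees F A ↔ 1 ≤ d ∧ HasMatrixUnits (1 : A) d := by
  refine and_congr_right fun hd => ⟨?_, ?_⟩
  · rintro ⟨B, ⟨g⟩⟩
    have h : HasMatrixUnits (1 : Matrix (Fin d) (Fin d) F) d := by
      simpa using (FactorsThrough.one (F := F) (m := Fin d)).hasMatrixUnits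
    simpa using h.map (B.val.comp g.symm.toAlgHom)
  · rintro ⟨e, he, hs⟩
    have := hA.nontrivial
    have : Nonempty (Fin d) := ⟨⟨0, hd⟩⟩
    let f : Matrix (Fin d) (Fin d) F →ₐ[F] A := AlgHom.ofLinearMap
      (∑ i, ∑ j, (LinearMap.toSpanSingleton F A (e i j)).comp
        ((Matrix.entryLinearMap F F i j))) (by
          simp [Matrix.one_apply, Finset.sum_ite_eq, hs]) (fun x y => by
          simp only [LinearMap.sum_apply, LinearMap.comp_apply, Matrix.entryLinearMap_apply,
            LinearMap.toSpanSingleton_apply, Finset.sum_mul, Finset.mul_sum, smul_mul_smul_comm,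
            he, Matrix.mul_apply, Finset.sum_smul]
          simp only [smul_ite, smul_zero, Finset.sum_ite_eq', Finset.mem_univ, if_true]
          symm
          rw [Finset.sum_comm, Finset.sum_comm_cycle])
    have hf : Function.Injective f := f.toRingHom.injective
    exact ⟨f.range, ⟨(AlgEquiv.ofInjective f hf).symm⟩⟩

/-- Matrix units in a locally matrix algebra, together with finitely many further elements and
the image of a full matrix algebra, come from a larger full matrix algebra. -/
theorem exists_algHom (hA : IsUnitalLocallyMatrix F A) {ε : A} {d : ℕ} (h : HasMatrixUnits ε d)
    {s : Set A} (hs : s.Finite) {n : ℕ} (φ : Matrix (Fin n) (Fin n) F →ₐ[F] A) :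
    ∃ N : ℕ, 1 ≤ N ∧ ∃ f : Matrix (Fin N) (Fin N) F →ₐ[F] A, Function.Injective f ∧
      s ⊆ Set.range f ∧ (∃ ε', f ε' = ε ∧ HasMatrixUnits ε' d) ∧
      ∃ g : Matrix (Fin n) (Fin n) F →ₐ[F] Matrix (Fin N) (Fin N) F, f.comp g = φ := by
  obtain ⟨e, he, rfl⟩ := h
  obtain ⟨N, hN, f, hf, hsf⟩ := isUnitalLocallyMatrix_iff.1 hA
    (s ∪ ((Set.range fun p : Fin d × Fin d => e p.1 p.2) ∪
      Set.range fun p : Fin n × Fin n => φ (Matrix.single p.1 p.2 1)))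
    (hs.union ((Set.finite_range _).union (Set.finite_range _)))
  simp only [Set.union_subset_iff] at hsf
  obtain ⟨hsf, hef, hφf⟩ := hsf
  choose e' he' using fun i j => hef (Set.mem_range_self (i, j))
  refine ⟨N, hN, f, hf, hsf, ⟨∑ i, e' i i, by simp [he'], e', fun i j k l => hf ?_, rfl⟩, ?_⟩
  · rw [map_mul, he', he', he]
    split_ifs <;> simp [he']
  · refine AlgHom.exists_comp_eq hf fun x => ?_
    rw [Matrix.matrix_eq_sum_single x, map_sum]
    refine sum_mem fun i _ => ?_
    rw [map_sum]
    refine sum_mem fun j _ => ?_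
    have : Matrix.single i j (x i j) = x i j • Matrix.single i j (1 : F) := by
      simp [Matrix.smul_single]
    rw [this, map_smul]
    exact f.range.smul_mem (hφf (Set.mem_range_self (i, j))) _

theorem op (hA : IsUnitalLocallyMatrix F A) : IsUnitalLocallyMatrix F Aᵐᵒᵖ := by
  refine isUnitalLocallyMatrix_iff.2 fun s hs => ?_
  obtain ⟨n, hn, f, hf, hsf⟩ := isUnitalLocallyMatrix_iff.1 hA _ (hs.image MulOpposite.unop)
  refine ⟨n, hn, (AlgHom.op f).comp (Matrix.transposeAlgEquiv (Fin n) F F).toAlgHom, ?_, ?_⟩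
  · exact (MulOpposite.op_injective.comp (hf.comp MulOpposite.unop_injective)).comp
      (Matrix.transposeAlgEquiv (Fin n) F F).injective
  · intro x hx
    obtain ⟨y, hy⟩ := hsf ⟨x, hx, rfl⟩
    exact ⟨y.transpose, by simp [hy]⟩

theorem matrixDegrees_op (hA : IsUnitalLocallyMatrix F A) :
    matrixDegrees F Aᵐᵒᵖ = matrixDegrees F A := by
  ext d
  rw [hA.op.mem_matrixDegrees_iff, hA.mem_matrixDegrees_iff, HasMatrixUnits.one_op_iff]

theorem exists_algHom_matrix (hA : IsUnitalLocallyMatrix F A) (k : ℕ)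
    {s : Set (Matrix (Fin k) (Fin k) A)} (hs : s.Finite) :
    ∃ d ∈ matrixDegrees F A, ∃ f : Matrix (Fin (k * d)) (Fin (k * d)) F →ₐ[F]
      Matrix (Fin k) (Fin k) A, Function.Injective f ∧ s ⊆ Set.range f := by
  obtain ⟨d, hd, f, hf, hsf⟩ := isUnitalLocallyMatrix_iff.1 hA
    (⋃ x ∈ s, Set.range fun p : Fin k × Fin k => x p.1 p.2)
    (hs.biUnion fun _ _ => Set.finite_range _)
  let g := (Matrix.reindexAlgEquiv F F (finProdFinEquiv (m := k) (n := d))).symm.trans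
    (Matrix.compAlgEquiv (Fin k) (Fin d) F F).symm
  refine ⟨d, ⟨hd, f.range, ⟨(AlgEquiv.ofInjective f hf).symm⟩⟩, f.mapMatrix.comp g.toAlgHom,
    ?_, fun x hx => ?_⟩
  · exact (Matrix.map_injective hf).comp g.injective
  · choose y hy using fun i j => hsf (Set.mem_biUnion hx (Set.mem_range_self (i, j)))
    refine ⟨g.symm (.of y), ?_⟩
    ext i j
    simp [hy]

theorem matrix (hA : IsUnitalLocallyMatrix F A) {k : ℕ} (hk : 0 < k) :
    IsUnitalLocallyMatrix F (Matrix (Fin k) (Fin k) A) := by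
  refine isUnitalLocallyMatrix_iff.2 fun s hs => ?_
  obtain ⟨d, hd, f, hf, hsf⟩ := hA.exists_algHom_matrix k hs
  exact ⟨k * d, Nat.mul_pos hk hd.1, f, hf, hsf⟩

end IsUnitalLocallyMatrix

theorem HasMatrixUnits.dvd {n d : ℕ} (hd : 1 ≤ d)
    (h : HasMatrixUnits (1 : Matrix (Fin n) (Fin n) F) d) : d ∣ n := by
  obtain ⟨r, hr⟩ := h.exists_factorsThrough hd
  exact ⟨r, by simpa using FactorsThrough.one.card_eq hr⟩

theorem mem_matrixDegrees_of_algHom {n : ℕ} (hn : 1 ≤ n) (f : Matrix (Fin n) (Fin n) F →ₐ[F] A)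
    (hf : Function.Injective f) : n ∈ matrixDegrees F A :=
  ⟨hn, f.range, ⟨(AlgEquiv.ofInjective f hf).symm⟩⟩

/-- The divisor set encoding the Steinitz number `k · st(A)`. -/
def steinitzDivisors (F : Type*) [Field F] (A : Type*) [Ring A] [Algebra F A] (k : ℕ) : Set ℕ :=
  {m | ∃ d ∈ matrixDegrees F A, m ∣ k * d}

namespace IsUnitalLocallyMatrix

theorem steinitzDivisors_matrix (hA : IsUnitalLocallyMatrix F A) {k : ℕ} (hk : 0 < k) (l : ℕ) :
    steinitzDivisors F (Matrix (Fin k) (Fin k) A) l = steinitzDivisors F A (l * k) := by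
  ext m
  constructor
  · rintro ⟨d, hd, hm⟩
    obtain ⟨hd, e, he, hs⟩ := (hA.matrix hk).mem_matrixDegrees_iff.1 hd
    obtain ⟨n, hn, f, hf, hsf⟩ := hA.exists_algHom_matrix k
      (Set.finite_range fun p : Fin d × Fin d => e p.1 p.2)
    choose e' he' using fun i j => hsf (Set.mem_range_self (i, j))
    have h : HasMatrixUnits (1 : Matrix (Fin (k * n)) (Fin (k * n)) F) d := by
      refine ⟨e', fun i j k l => hf ?_, hf ?_⟩
      · rw [map_mul, he', he', he]
        split_ifs <;> simp [he']
      · simp [he', hs]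
    exact ⟨n, hn, hm.trans (by simpa [mul_assoc] using Nat.mul_dvd_mul_left l (h.dvd hd))⟩
  · rintro ⟨d, hd, hm⟩
    obtain ⟨hd, e, he, hs⟩ := hA.mem_matrixDegrees_iff.1 hd
    refine ⟨k * d, (hA.matrix hk).mem_matrixDegrees_iff.2 ⟨Nat.mul_pos hk hd, ?_⟩,
      by simpa [mul_assoc] using hm⟩
    have := HasMatrixUnits.of_fintype (ι := Fin k × Fin d) (ε := (1 : Matrix (Fin k) (Fin k) A))
      (fun i j => Matrix.single i.1 j.1 (e i.2 j.2)) (fun i j p q => ?_) ?_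
    · simpa using this
    · by_cases h : j.1 = p.1
      · rw [h, Matrix.single_mul_single_same, he]
        simp only [Prod.ext_iff, h, true_and]
        split_ifs <;> simp
      · rw [Matrix.single_mul_single_of_ne _ _ _ _ h, if_neg (fun h' => h (by rw [h']))]
    · rw [Fintype.sum_prod_type]
      simp_rw [← Matrix.singleAddMonoidHom_apply, ← map_sum, hs]
      simp [Matrix.sum_single_one]

theorem steinitzDivisors_eq_of_corner (hA : IsUnitalLocallyMatrix F A) {B : Type*} [Ring B]
    [Algebra F B] (hB : IsUnitalLocallyMatrix F B) {ε : B} (hε : ε * ε = ε)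
    (h : ∀ d, HasMatrixUnits (1 : A) d ↔ HasMatrixUnits ε d) :
    ∃ k l : ℕ, 0 < k ∧ 0 < l ∧ steinitzDivisors F A k = steinitzDivisors F B l := by
  obtain ⟨n, hn, f, hf, hsf⟩ := isUnitalLocallyMatrix_iff.1 hB {ε} (Set.finite_singleton ε)
  obtain ⟨ε, rfl⟩ := hsf rfl
  obtain ⟨a, ha⟩ := exists_factorsThrough (hf (by simpa using hε) : ε * ε = ε)
  have ha0 : 0 < a := by
    refine Nat.pos_of_ne_zero fun ha0 => ?_
    subst ha0
    obtain ⟨U, V, rfl, -⟩ := ha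
    have := hA.nontrivial
    have hUV : U * V = 0 := by
      ext
      simp [Matrix.mul_apply]
    obtain ⟨e, -, he⟩ := (h 0).2 ⟨fun i => i.elim0, fun i => i.elim0, by simp [hUV]⟩
    simp at he
  refine ⟨n, a, hn, ha0, ?_⟩
  ext m
  constructor
  · rintro ⟨d, hd, hm⟩
    obtain ⟨hd, hu⟩ := hA.mem_matrixDegrees_iff.1 hd
    obtain ⟨N, hN, g, hg, -, ⟨ε', hε', hu'⟩, φ, rfl⟩ :=
      hB.exists_algHom ((h d).1 hu) Set.finite_empty f
    obtain ⟨t, ht, hF⟩ := ha.map_algHom hn φ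
    obtain rfl : N = n * t := by simpa using ht
    have hφ : ε' = φ ε := hg hε'
    rw [← hφ] at hF
    obtain ⟨r, hr⟩ := hu'.exists_factorsThrough hd
    have hdvd : d ∣ a * t := ⟨r, by simpa using hF.card_eq hr⟩
    refine ⟨n * t, mem_matrixDegrees_of_algHom hN g hg, hm.trans ?_⟩
    rw [mul_left_comm]
    exact Nat.mul_dvd_mul_left n hdvd
  · rintro ⟨d, hd, hm⟩
    obtain ⟨hd, hu⟩ := hB.mem_matrixDegrees_iff.1 hd
    obtain ⟨N, hN, g, hg, -, ⟨ε', hε', hu'⟩, φ, rfl⟩ := hB.exists_algHom hu Set.finite_empty f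
    obtain ⟨t, ht, hF⟩ := ha.map_algHom hn φ
    obtain rfl : N = n * t := by simpa using ht
    have hF' := hF.hasMatrixUnits.map g
    have hdvd : d ∣ n * t := by
      have : ε' = 1 := hg (by rw [hε', map_one])
      exact (this ▸ hu').dvd hd
    refine ⟨a * t, hA.mem_matrixDegrees_iff.2 ⟨Nat.mul_pos ha0 (Nat.pos_of_mul_pos_left hN), ?_⟩,
      hm.trans ?_⟩
    · rw [h]
      simpa using hF'
    · rw [mul_left_comm]
      exact Nat.mul_dvd_mul_left a hdvd

end IsUnitalLocallyMatrix

end LocallyMatrix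

section Glimm

variable {F : Type*} [Field F] {A B : Type*} [Ring A] [Algebra F A] [Ring B] [Algebra F B]

theorem exists_algHom_of_dvd (F : Type*) [Field F] {m n : ℕ} (h : m ∣ n) :
    Nonempty (Matrix (Fin m) (Fin m) F →ₐ[F] Matrix (Fin n) (Fin n) F) := by
  obtain ⟨t, rfl⟩ := h
  exact ⟨((Matrix.reindexAlgEquiv F F (finProdFinEquiv (m := m) (n := t))).toAlgHom.comp
    (Matrix.compAlgEquiv (Fin m) (Fin t) F F).toAlgHom).comp
    (Algebra.ofId F (Matrix (Fin t) (Fin t) F)).mapMatrix⟩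

namespace IsUnitalLocallyMatrix

/-- The extension step of the back-and-forth construction. -/
theorem exists_extension (hA : IsUnitalLocallyMatrix F A) (hB : IsUnitalLocallyMatrix F B)
    (h : ∀ m ∈ matrixDegrees F A, ∃ d ∈ matrixDegrees F B, m ∣ d) {n : ℕ} (hn : 1 ≤ n)
    (f₁ : Matrix (Fin n) (Fin n) F →ₐ[F] A) (f₂ : Matrix (Fin n) (Fin n) F →ₐ[F] B) (a : A) :
    ∃ m : ℕ, 1 ≤ m ∧ ∃ (g₁ : Matrix (Fin m) (Fin m) F →ₐ[F] A)
      (g₂ : Matrix (Fin m) (Fin m) F →ₐ[F] B)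
      (φ : Matrix (Fin n) (Fin n) F →ₐ[F] Matrix (Fin m) (Fin m) F),
      g₁.comp φ = f₁ ∧ g₂.comp φ = f₂ ∧ a ∈ Set.range g₁ := by
  have h1 : HasMatrixUnits (1 : A) 1 := ⟨fun _ _ => 1, by simp [Fin.eq_zero], by simp⟩
  obtain ⟨m, hm, g₁, hg₁, ha, -, φ, hφ⟩ := hA.exists_algHom h1 (Set.finite_singleton a) f₁
  obtain ⟨d, hd, hmd⟩ := h m (mem_matrixDegrees_of_algHom hm g₁ hg₁)
  obtain ⟨hd, hu⟩ := hB.mem_matrixDegrees_iff.1 hd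
  obtain ⟨N, hN, k, hk, -, ⟨ε, hε, hu'⟩, ψ, hψ⟩ := hB.exists_algHom hu Set.finite_empty f₂
  obtain rfl : ε = 1 := hk (by rw [hε, map_one])
  obtain ⟨j⟩ := exists_algHom_of_dvd F (hmd.trans (hu'.dvd hd))
  obtain ⟨c, hc⟩ := exists_comp_eq_of_algHom hn (j.comp φ) ψ
  refine ⟨m, hm, g₁, k.comp (c.comp j), φ, hφ, ?_, ha rfl⟩
  rw [← hψ, ← hc, AlgHom.comp_assoc, AlgHom.comp_assoc]

/-- Unital locally matrix algebras of countable dimension are isomorphic if they have the same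
Steinitz number. -/
theorem nonempty_algEquiv (hA : IsUnitalLocallyMatrix F A) (hB : IsUnitalLocallyMatrix F B)
    (hdimA : Module.rank F A ≤ Cardinal.aleph0) (hdimB : Module.rank F B ≤ Cardinal.aleph0)
    (h : steinitzDivisors F A 1 = steinitzDivisors F B 1) : Nonempty (A ≃ₐ[F] B) := by
  have := hA.nontrivial
  have := hB.nontrivial
  have hAB : ∀ m ∈ matrixDegrees F A, ∃ d ∈ matrixDegrees F B, m ∣ d := fun m hm => by
    have : m ∈ steinitzDivisors F B 1 := h ▸ ⟨m, hm, by simp⟩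
    simpa [steinitzDivisors] using this
  have hBA : ∀ m ∈ matrixDegrees F B, ∃ d ∈ matrixDegrees F A, m ∣ d := fun m hm => by
    have : m ∈ steinitzDivisors F A 1 := h ▸ ⟨m, hm, by simp⟩
    simpa [steinitzDivisors] using this
  let P := {Γ : Subalgebra F (A × B) // ∃ n : ℕ, 1 ≤ n ∧
    ∃ f : Matrix (Fin n) (Fin n) F →ₐ[F] A × B, f.range = Γ}
  have hP : ∀ (Γ : P), ∀ x ∈ Γ.1, x.1 = 0 ↔ x.2 = 0 := by
    rintro ⟨_, n, hn, f, rfl⟩ _ ⟨x, rfl⟩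
    have : Nonempty (Fin n) := ⟨⟨0, hn⟩⟩
    have h₁ := map_eq_zero_iff ((AlgHom.fst F A B).comp f)
      ((AlgHom.fst F A B).comp f).toRingHom.injective (x := x)
    have h₂ := map_eq_zero_iff ((AlgHom.snd F A B).comp f)
      ((AlgHom.snd F A B).comp f).toRingHom.injective (x := x)
    exact h₁.trans h₂.symm
  let bA := Module.Free.chooseBasis F A
  let bB := Module.Free.chooseBasis F B
  have : Countable (Module.Free.ChooseBasisIndex F A) := by
    rw [← Cardinal.mk_le_aleph0_iff, ← Module.Free.rank_eq_card_chooseBasisIndex]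
    exact hdimA
  have : Countable (Module.Free.ChooseBasisIndex F B) := by
    rw [← Cardinal.mk_le_aleph0_iff, ← Module.Free.rank_eq_card_chooseBasisIndex]
    exact hdimB
  let CA : A → Order.Cofinal P := fun a =>
    { carrier := {Γ | ∃ x ∈ Γ.1, x.1 = a}
      isCofinal := by
        rintro ⟨_, n, hn, f, rfl⟩
        obtain ⟨m, hm, g₁, g₂, φ, h₁, h₂, y, hy⟩ := exists_extension hA hB hAB hn
          ((AlgHom.fst F A B).comp f) ((AlgHom.snd F A B).comp f) a
        refine ⟨⟨(g₁.prod g₂).range, m, hm, _, rfl⟩, ⟨_, ⟨y, rfl⟩, hy⟩, ?_⟩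
        rintro _ ⟨x, rfl⟩
        exact ⟨φ x, Prod.ext (DFunLike.congr_fun h₁ x) (DFunLike.congr_fun h₂ x)⟩ }
  let CB : B → Order.Cofinal P := fun b =>
    { carrier := {Γ | ∃ x ∈ Γ.1, x.2 = b}
      isCofinal := by
        rintro ⟨_, n, hn, f, rfl⟩
        obtain ⟨m, hm, g₂, g₁, φ, h₂, h₁, y, hy⟩ := exists_extension hB hA hBA hn
          ((AlgHom.snd F A B).comp f) ((AlgHom.fst F A B).comp f) b
        refine ⟨⟨(g₁.prod g₂).range, m, hm, _, rfl⟩, ⟨_, ⟨y, rfl⟩, hy⟩, ?_⟩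
        rintro _ ⟨x, rfl⟩
        exact ⟨φ x, Prod.ext (DFunLike.congr_fun h₁ x) (DFunLike.congr_fun h₂ x)⟩ }
  let f₀ : Matrix (Fin 1) (Fin 1) F →ₐ[F] A × B :=
    (Algebra.ofId F (A × B)).comp (AlgHom.ofLinearMap (Matrix.entryLinearMap F F 0 0) (by simp)
      fun x y => by simp [Matrix.mul_apply])
  let p₀ : P := ⟨f₀.range, 1, le_rfl, f₀, rfl⟩
  have := Encodable.ofCountable (Module.Free.ChooseBasisIndex F A)
  have := Encodable.ofCountable (Module.Free.ChooseBasisIndex F B)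
  let C := Sum.elim (fun i => CA (bA i)) (fun i => CB (bB i))
  let I := Order.idealOfCofinals p₀ C
  have hI := Order.cofinal_meets_idealOfCofinals p₀ C
  let Γ : Subalgebra F (A × B) := ⨆ p : I, p.1.1
  have hne : Nonempty I := ⟨⟨p₀, Order.mem_idealOfCofinals p₀ C⟩⟩
  have hdir : Directed (· ≤ ·) fun p : I => p.1.1 := fun p q => by
    obtain ⟨r, hr, hpr, hqr⟩ := I.directed _ p.2 _ q.2
    exact ⟨⟨r, hr⟩, hpr, hqr⟩
  have hΓ : ∀ x ∈ Γ, x.1 = 0 ↔ x.2 = 0 := fun x hx => by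
    have : x ∈ (Γ : Set (A × B)) := hx
    rw [Subalgebra.coe_iSup_of_directed hdir, Set.mem_iUnion] at this
    obtain ⟨p, hp⟩ := this
    exact hP p.1 x hp
  let π₁ : Γ →ₐ[F] A := (AlgHom.fst F A B).comp Γ.val
  let π₂ : Γ →ₐ[F] B := (AlgHom.snd F A B).comp Γ.val
  have h₁ : Function.Bijective π₁ := by
    refine ⟨(injective_iff_map_eq_zero _).2 fun x hx => Subtype.ext (Prod.ext hx ?_), ?_⟩
    · exact (hΓ x.1 x.2).1 hx
    · have : Subalgebra.toSubmodule π₁.range = ⊤ := by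
        rw [eq_top_iff, ← bA.span_eq, Submodule.span_le]
        rintro _ ⟨i, rfl⟩
        obtain ⟨p, ⟨x, hx, hxi⟩, hp⟩ := hI (.inl i)
        exact ⟨⟨x, le_iSup (fun p : I => p.1.1) ⟨p, hp⟩ hx⟩, hxi⟩
      exact AlgHom.range_eq_top _ |>.1 (Algebra.toSubmodule_eq_top.1 this)
  have h₂ : Function.Bijective π₂ := by
    refine ⟨(injective_iff_map_eq_zero _).2 fun x hx => Subtype.ext (Prod.ext ?_ hx), ?_⟩
    · exact (hΓ x.1 x.2).2 hx
    · have : Subalgebra.toSubmodule π₂.range = ⊤ := by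
        rw [eq_top_iff, ← bB.span_eq, Submodule.span_le]
        rintro _ ⟨i, rfl⟩
        obtain ⟨p, ⟨x, hx, hxi⟩, hp⟩ := hI (.inr i)
        exact ⟨⟨x, le_iSup (fun p : I => p.1.1) ⟨p, hp⟩ hx⟩, hxi⟩
      exact AlgHom.range_eq_top _ |>.1 (Algebra.toSubmodule_eq_top.1 this)
  exact ⟨(AlgEquiv.ofBijective π₁ h₁).symm.trans (AlgEquiv.ofBijective π₂ h₂)⟩

end IsUnitalLocallyMatrix

end Glimm

section Morita

open CategoryTheory

/-- If `X` is a retract of `Yⁿ`, then `1 : End X` and the corresponding idempotent matrix over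
`End Y` are sums of the same matrix units. -/
theorem exists_hasMatrixUnits_one_end_iff {C : Type*} [Category C] [Preadditive C] {X Y : C} {n : ℕ}
    (s : Fin n → (X ⟶ Y)) (t : Fin n → (Y ⟶ X)) (h : ∑ i, s i ≫ t i = 𝟙 X) :
    ∃ ε : Matrix (Fin n) (Fin n) (End Y), ε * ε = ε ∧
      ∀ d, HasMatrixUnits (1 : End X) d ↔ HasMatrixUnits ε d := by
  have hc : ∀ (x y : End X) (i j : Fin n),
      ∑ k, (t j ≫ y ≫ s k) ≫ (t k ≫ x ≫ s i) = t j ≫ y ≫ x ≫ s i := fun x y i j => by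
    calc _ = t j ≫ y ≫ (∑ k, s k ≫ t k) ≫ x ≫ s i := by
          simp [Preadditive.sum_comp, Preadditive.comp_sum]
      _ = _ := by simp [h]
  let f : End X →ₙ+* Matrix (Fin n) (Fin n) (End Y) :=
    { toFun x := Matrix.of fun i j => t j ≫ x ≫ s i
      map_mul' x y := by
        ext i j
        have : t j ≫ (x * y) ≫ s i = t j ≫ y ≫ x ≫ s i := by simp [End.mul_def]
        exact this.trans (hc x y i j).symm
      map_zero' := by
        ext i j
        have : t j ≫ (0 : X ⟶ X) ≫ s i = (0 : Y ⟶ Y) := by simp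
        exact this
      map_add' x y := by
        ext i j
        have (x y : X ⟶ X) : t j ≫ (x + y) ≫ s i = t j ≫ x ≫ s i + t j ≫ y ≫ s i := by simp
        exact this x y }
  let g : Matrix (Fin n) (Fin n) (End Y) →+ End X :=
    { toFun x := (∑ i, ∑ j, s j ≫ x i j ≫ t i : X ⟶ X)
      map_zero' := by
        have : ∑ i, ∑ j, s j ≫ (0 : Y ⟶ Y) ≫ t i = (0 : X ⟶ X) := by simp
        exact this
      map_add' x y := by
        have (x y : Fin n → Fin n → (Y ⟶ Y)) : ∑ i, ∑ j, s j ≫ (x i j + y i j) ≫ t i =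
            ∑ i, ∑ j, s j ≫ x i j ≫ t i + ∑ i, ∑ j, s j ≫ y i j ≫ t i := by
          simp [Finset.sum_add_distrib]
        exact this x y }
  have hg : ∀ x y, g (x * f 1 * y) = g x * g y := fun x y => by
    have (x y : Fin n → Fin n → (Y ⟶ Y)) :
        ∑ i, ∑ j, s j ≫ (∑ l, y l j ≫ ∑ k, (t l ≫ 𝟙 X ≫ s k) ≫ x i k) ≫ t i =
          (∑ i, ∑ j, s j ≫ y i j ≫ t i) ≫ ∑ i, ∑ j, s j ≫ x i j ≫ t i := by
      simp only [Preadditive.sum_comp, Preadditive.comp_sum, Category.assoc, Category.id_comp]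
      refine Finset.sum_congr rfl fun i _ => Finset.sum_comm_cycle.trans ?_
      exact Finset.sum_congr rfl fun k _ => Finset.sum_comm
    exact this x y
  have hg1 : g (f 1) = 1 := by
    have : ∑ i, ∑ j, s j ≫ (t j ≫ 𝟙 X ≫ s i) ≫ t i = 𝟙 X :=
      calc _ = (∑ j, s j ≫ t j) ≫ ∑ i, s i ≫ t i := by
            simp only [Preadditive.sum_comp, Preadditive.comp_sum, Category.assoc, Category.id_comp]
        _ = 𝟙 X := by simp [h]
    exact this
  exact ⟨f 1, by rw [← map_mul, mul_one], fun d => HasMatrixUnits.corner_iff f g rfl hg hg1⟩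

/-- Equivalences of preadditive categories induce isomorphisms of endomorphism rings. -/
theorem nonempty_ringEquiv_end {C D : Type*} [Category C] [Category D] [Preadditive C]
    [Preadditive D] (G : C ⥤ D) [G.Full] [G.Faithful] [G.Additive] (X : C) :
    Nonempty (End X ≃+* End (G.obj X)) :=
  ⟨{ (Functor.FullyFaithful.ofFullyFaithful G).mulEquivEnd X with
      map_add' := fun _ _ => G.map_add }⟩

universe w

theorem ModuleCat.nonempty_end_ringEquiv_op (R : Type*) [Ring R] [Small.{w} R] :
    Nonempty (End (ModuleCat.of.{w} R (Shrink.{w} R)) ≃+* Rᵐᵒᵖ) :=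
  ⟨(ModuleCat.endRingEquiv _).trans
    ((Shrink.linearEquiv R R).conjRingEquiv.trans (RingEquiv.moduleEndSelf R).symm)⟩

/-- A ring is a retract of a finite power of any separator of its module category. -/
theorem ModuleCat.exists_sum_comp_eq_id_of_isSeparator {R : Type*} [Ring R] [Small.{w} R]
    {Q : ModuleCat.{w} R} (hQ : IsSeparator Q) :
    ∃ (n : ℕ) (s : Fin n → (ModuleCat.of R (Shrink.{w} R) ⟶ Q))
      (t : Fin n → (Q ⟶ ModuleCat.of R (Shrink.{w} R))), ∑ i, s i ≫ t i = 𝟙 _ := by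
  let e := Shrink.linearEquiv.{w} R R
  let T : Submodule R (Shrink.{w} R) := ⨆ t : Q →ₗ[R] Shrink.{w} R, LinearMap.range t
  have hT : T = ⊤ := by
    have : ModuleCat.ofHom T.mkQ = 0 := hQ.def _ _ fun h => by
      ext x
      exact (Submodule.Quotient.mk_eq_zero T).2 (le_iSup (fun t : Q →ₗ[R] Shrink.{w} R =>
        LinearMap.range t) h.hom ⟨x, rfl⟩)
    rw [← T.ker_mkQ, LinearMap.ker_eq_top]
    exact congrArg ModuleCat.Hom.hom this
  obtain ⟨c, hc, hc1⟩ := (Submodule.mem_iSup_iff_exists_finsupp _ _).1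
    (hT ▸ Submodule.mem_top : e.symm 1 ∈ T)
  choose q hq using hc
  let σ := c.support.equivFin
  refine ⟨_, fun i => ModuleCat.ofHom
    (LinearMap.toSpanSingleton R Q (q (σ.symm i)) ∘ₗ e.toLinearMap),
    fun i => ModuleCat.ofHom (σ.symm i : Q →ₗ[R] Shrink.{w} R), ?_⟩
  ext x
  have hsum : ∑ i, c (σ.symm i) = e.symm 1 := by
    rw [σ.symm.sum_comp (fun i => c i), Finset.sum_coe_sort c.support c]
    exact hc1
  simp only [ModuleCat.hom_sum, LinearMap.sum_apply, ModuleCat.hom_comp, LinearMap.comp_apply,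
    ModuleCat.hom_ofHom, LinearMap.toSpanSingleton_apply, map_smul, hq, ← Finset.smul_sum]
  simp [hsum, ← map_smul]

variable {F : Type*} [Field F] {A : Type u} {B : Type v} [Ring A] [Ring B] [Algebra F A]
  [Algebra F B]

theorem MoritaEquiv.exists_steinitzDivisors_eq (h : MoritaEquiv A B)
    (hA : IsUnitalLocallyMatrix F A) (hB : IsUnitalLocallyMatrix F B) :
    ∃ k l : ℕ, 0 < k ∧ 0 < l ∧ steinitzDivisors F A k = steinitzDivisors F B l := by
  obtain ⟨G⟩ := h
  have := hA.nontrivial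
  have : G.inverse.Additive := Functor.additive_of_preserves_binary_products _
  obtain ⟨n, s, t, hst⟩ := ModuleCat.exists_sum_comp_eq_id_of_isSeparator
    ((ModuleCat.isSeparator.{v, max u v} B).of_equivalence G.symm)
  obtain ⟨ε, hε, hd⟩ := exists_hasMatrixUnits_one_end_iff s t hst
  obtain ⟨eA⟩ := ModuleCat.nonempty_end_ringEquiv_op.{max u v} A
  obtain ⟨eB⟩ := ModuleCat.nonempty_end_ringEquiv_op.{max u v} B
  obtain ⟨eG⟩ := nonempty_ringEquiv_end G.inverse (ModuleCat.of.{max u v} B (Shrink.{max u v} B))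
  let e := (eG.symm.trans eB).mapMatrix (m := Fin n)
  have hn : 0 < n := by
    refine Nat.pos_of_ne_zero fun hn => ?_
    subst hn
    have h01 : (1 : End (ModuleCat.of.{max u v} A (Shrink.{max u v} A))) = 0 := hst.symm
    exact one_ne_zero (α := Aᵐᵒᵖ) (by rw [← map_one eA, h01, map_zero])
  obtain ⟨k, l, hk, hl, hkl⟩ := hA.steinitzDivisors_eq_of_corner (hB.op.matrix hn)
    (by rw [← map_mul, hε] : e ε * e ε = e ε) fun d => by
      rw [HasMatrixUnits.map_ringEquiv_iff, ← hd, HasMatrixUnits.one_iff_of_ringEquiv eA,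
        HasMatrixUnits.one_op_iff]
  refine ⟨k, l * n, hk, Nat.mul_pos hl hn, ?_⟩
  rw [hkl, hB.op.steinitzDivisors_matrix hn, steinitzDivisors, hB.matrixDegrees_op]
  rfl

theorem MoritaEquiv.of_matrix_ringEquiv {k l : ℕ} (hk : 0 < k) (hl : 0 < l)
    (e : Matrix (Fin k) (Fin k) A ≃+* Matrix (Fin l) (Fin l) B) : MoritaEquiv A B :=
  ⟨(ModuleCat.matrixEquivalence A (⟨0, hk⟩ : Fin k)).trans
    ((ModuleCat.restrictScalarsEquivalenceOfRingEquiv e.symm).trans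
      (ModuleCat.matrixEquivalence B (⟨0, hl⟩ : Fin l)).symm)⟩

end Morita

theorem rank_matrix_le_aleph0 {F A : Type*} [Field F] [Ring A] [Algebra F A] (n : ℕ)
    (hA : Module.rank F A ≤ Cardinal.aleph0) :
    Module.rank F (Matrix (Fin n) (Fin n) A) ≤ Cardinal.aleph0 := by
  rw [rank_matrix_module]
  refine (mul_le_mul' (mul_le_mul' ?_ ?_) ?_).trans_eq
    ((congrArg (· * _) Cardinal.aleph0_mul_aleph0).trans Cardinal.aleph0_mul_aleph0)
  · simp
  · simp
  · simpa using hA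

/-- Countable dimensional unital locally matrix algebras `A`, `B` are Morita equivalent
if and only if their Steinitz numbers are rationally connected: there exist positive
integers `k`, `l` with `k · st(A) = l · st(B)`, encoded by equality of divisor sets. -/
theorem morita_equivalent_iff_rationally_connected
    (F : Type*) [Field F]
    (A : Type u) (B : Type v) [Ring A] [Ring B] [Algebra F A] [Algebra F B]
    (hA : IsUnitalLocallyMatrix F A) (hB : IsUnitalLocallyMatrix F B)
    (hdimA : Module.rank F A ≤ Cardinal.aleph0)
    (hdimB : Module.rank F B ≤ Cardinal.aleph0) :
    MoritaEquiv A B ↔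
      ∃ k l : ℕ, 0 < k ∧ 0 < l ∧
        {m : ℕ | ∃ d ∈ matrixDegrees F A, m ∣ k * d} =
          {m : ℕ | ∃ d ∈ matrixDegrees F B, m ∣ l * d} := by
  refine ⟨fun h => h.exists_steinitzDivisors_eq hA hB, fun ⟨k, l, hk, hl, h⟩ => ?_⟩
  have hkl : steinitzDivisors F (Matrix (Fin k) (Fin k) A) 1 =
      steinitzDivisors F (Matrix (Fin l) (Fin l) B) 1 := by
    rw [hA.steinitzDivisors_matrix hk, hB.steinitzDivisors_matrix hl, one_mul, one_mul]
    exact h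
  obtain ⟨e⟩ := (hA.matrix hk).nonempty_algEquiv (hB.matrix hl)
    (rank_matrix_le_aleph0 k hdimA) (rank_matrix_le_aleph0 l hdimB) hkl
  exact .of_matrix_ringEquiv hk hl e.toRingEquiv
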